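/- Let Ω be a bounded domain in ℝⁿ, n ≥ 2, whose complement ℝⁿ \ Ω is η-plump for some η ≥ 1. Let Q ⊂ Ω be a closed axis-parallel cube satisfying diam(Q) ≤ dist(Q, ∂Ω) ≤ 4 diam(Q). Then there exists a closed axis-parallel cube Q^s ⊂ ℝⁿ \ closure(Ω) with diam(Q^s) = diam(Q) and dist(Q, Q^s) ≤ 15 η diam(Q). In particular Q^s is contained in the dilated cube κQ with κ = 40 η √n, where κQ is the cube with the same center as Q and side length κ ℓ(Q). -/

import Mathlib

open MeasureTheory Metric ENNReal

noncomputable section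

/-- A set `A ⊆ ℝⁿ` is `η`-plump: for every `x` in the closure of `A` and every radius
`0 < r < diam A` there is `z` in the closed ball `B̄(x, r)` with `B(z, r/η) ⊆ A`. -/
def IsPlump {n : ℕ} (η : ℝ) (A : Set (EuclideanSpace ℝ (Fin n))) : Prop :=
  ∀ x ∈ closure A, ∀ r : ℝ, 0 < r → ENNReal.ofReal r < EMetric.diam A →
    ∃ z ∈ Metric.closedBall x r, Metric.ball z (r / η) ⊆ A

/-- The closed axis-parallel cube in `ℝⁿ` with center `c` and side length `ℓ`. -/
def cube {n : ℕ} (c : EuclideanSpace ℝ (Fin n)) (ℓ : ℝ) : Set (EuclideanSpace ℝ (Fin n)) :=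
  {y | ∀ i, |y i - c i| ≤ ℓ / 2}

/-- The Euclidean distance between two sets. -/
def setDist {n : ℕ} (A B : Set (EuclideanSpace ℝ (Fin n))) : ℝ :=
  (⨅ a ∈ A, ⨅ b ∈ B, edist a b).toReal

theorem cube_dist_center {n : ℕ} (c y : EuclideanSpace ℝ (Fin n)) (ℓ : ℝ) (hℓ : 0 < ℓ)
    (hy : y ∈ cube c ℓ) : dist y c ≤ Real.sqrt n * ℓ / 2 := by
  rw [EuclideanSpace.dist_eq]
  apply Real.sqrt_le_iff.2
  refine ⟨by positivity, ?_⟩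
  have h : ∀ i ∈ (Finset.univ : Finset (Fin n)), dist (y i) (c i) ^ 2 ≤ (ℓ / 2) ^ 2 := by
    intro i _
    rw [Real.dist_eq]
    exact pow_le_pow_left₀ (abs_nonneg _) (hy i) 2
  refine (Finset.sum_le_sum h).trans ?_
  have hs : Real.sqrt n ^ 2 = n := Real.sq_sqrt (Nat.cast_nonneg n)
  rw [mul_div_assoc, mul_pow, hs]
  simp

theorem cube_diam {n : ℕ} (c : EuclideanSpace ℝ (Fin n)) (ℓ : ℝ) (hℓ : 0 < ℓ) :
    Metric.diam (cube c ℓ) = Real.sqrt n * ℓ := by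
  have hsub : cube c ℓ ⊆ Metric.closedBall c (Real.sqrt n * ℓ / 2) :=
    fun y hy => cube_dist_center c y ℓ hℓ hy
  apply le_antisymm
  · apply Metric.diam_le_of_forall_dist_le (by positivity)
    intro x hx y hy
    have h1 := cube_dist_center c x ℓ hℓ hx
    have h2 := cube_dist_center c y ℓ hℓ hy
    have h3 := dist_triangle_right x y c
    linarith
  · have hb : Bornology.IsBounded (cube c ℓ) := Metric.isBounded_closedBall.subset hsub
    let v : EuclideanSpace ℝ (Fin n) := WithLp.toLp 2 (fun i => c i + ℓ / 2)
    let u : EuclideanSpace ℝ (Fin n) := WithLp.toLp 2 (fun i => c i - ℓ / 2)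
    have hv : v ∈ cube c ℓ := by
      intro i
      have : v i - c i = ℓ / 2 := by simp [v]
      rw [this, abs_of_pos (by positivity)]
    have hu : u ∈ cube c ℓ := by
      intro i
      have : u i - c i = -(ℓ / 2) := by simp [u]
      rw [this, abs_neg, abs_of_pos (by positivity)]
    have h := Metric.dist_le_diam_of_mem hb hv hu
    refine le_trans (le_of_eq ?_) h
    rw [EuclideanSpace.dist_eq]
    have h : ∀ i ∈ (Finset.univ : Finset (Fin n)), dist (v i) (u i) ^ 2 = ℓ ^ 2 := by
      intro i _
      have : v i - u i = ℓ := by simp [u, v]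
      rw [Real.dist_eq, this, sq_abs]
    rw [Finset.sum_congr rfl h]
    simp [Real.sqrt_sq hℓ.le]

/-- For a Whitney-type cube `Q ⊆ Ω` in a bounded domain with `η`-plump complement, there is a
reflected cube `Q^s` of the same size outside `closure Ω`, at distance at most `15 η diam Q`
from `Q`; in particular `Q^s ⊆ κQ` with `κ = 40 η √n`. -/
theorem reflected_cube_exists (n : ℕ) (hn : 2 ≤ n)
    (Ω : Set (EuclideanSpace ℝ (Fin n)))
    (hopen : IsOpen Ω) (hconn : IsConnected Ω) (hbdd : Bornology.IsBounded Ω)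
    (η : ℝ) (hη : 1 ≤ η) (hplump : IsPlump η Ωᶜ)
    (z : EuclideanSpace ℝ (Fin n)) (ℓ : ℝ) (hℓ : 0 < ℓ)
    (hQΩ : cube z ℓ ⊆ Ω)
    (hd1 : Metric.diam (cube z ℓ) ≤ setDist (cube z ℓ) (frontier Ω))
    (hd2 : setDist (cube z ℓ) (frontier Ω) ≤ 4 * Metric.diam (cube z ℓ)) :
    ∃ z' : EuclideanSpace ℝ (Fin n),
      cube z' ℓ ⊆ (closure Ω)ᶜ ∧
      setDist (cube z ℓ) (cube z' ℓ) ≤ 15 * η * Metric.diam (cube z ℓ) ∧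
      cube z' ℓ ⊆ cube z (40 * η * Real.sqrt n * ℓ) := by
  have hnpos : (0 : ℝ) < n := by exact_mod_cast (by omega : 0 < n)
  haveI : Nonempty (Fin n) := ⟨⟨0, by omega⟩⟩
  have hD := cube_diam z ℓ hℓ
  rw [hD] at hd1 hd2 ⊢
  have hdpos : 0 < Real.sqrt n * ℓ := mul_pos (Real.sqrt_pos.2 hnpos) hℓ
  have hrew : 40 * η * Real.sqrt n * ℓ = 40 * η * (Real.sqrt n * ℓ) := by ring
  rw [hrew]
  have hcc : ∀ w y : EuclideanSpace ℝ (Fin n), y ∈ cube w ℓ → dist y w ≤ Real.sqrt n * ℓ / 2 :=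
    fun w y hy => cube_dist_center w y ℓ hℓ hy
  generalize Real.sqrt n * ℓ = d at *
  have hηd : d ≤ η * d := le_mul_of_one_le_left hdpos.le hη
  -- a near-optimal pair
  obtain ⟨a, ha, x, hx, hax⟩ : ∃ a ∈ cube z ℓ, ∃ x ∈ frontier Ω, dist a x < 5 * d := by
    unfold setDist at hd1 hd2
    have htop : (⨅ a ∈ cube z ℓ, ⨅ b ∈ frontier Ω, edist a b) ≠ ⊤ := by
      intro h
      rw [h] at hd1
      simp at hd1
      linarith
    have hlt : (⨅ a ∈ cube z ℓ, ⨅ b ∈ frontier Ω, edist a b) < ENNReal.ofReal (5 * d) := by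
      rw [ENNReal.lt_ofReal_iff_toReal_lt htop]
      linarith
    simp only [iInf_lt_iff] at hlt
    obtain ⟨a, ha, x, hx, h⟩ := hlt
    refine ⟨a, ha, x, hx, ?_⟩
    rw [edist_dist] at h
    exact (ENNReal.ofReal_lt_ofReal_iff (by linarith)).1 h
  have hxc : x ∈ closure Ωᶜ := by
    rw [frontier_eq_closure_inter_closure] at hx
    exact hx.2
  have hdiam : EMetric.diam Ωᶜ = ⊤ := by
    by_contra h
    have h1 : Bornology.IsBounded Ωᶜ := Metric.isBounded_iff_ediam_ne_top.2 h
    have h2 := hbdd.union h1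
    rw [Set.union_compl_self] at h2
    haveI : Nontrivial (EuclideanSpace ℝ (Fin n)) := inferInstance
    exact NormedSpace.unbounded_univ ℝ (EuclideanSpace ℝ (Fin n)) h2
  obtain ⟨w, hw, hball⟩ := hplump x hxc (η * d) (by positivity)
    (by rw [hdiam]; exact ENNReal.ofReal_lt_top)
  have hdiv : η * d / η = d := by field_simp
  rw [hdiv] at hball
  rw [Metric.mem_closedBall] at hw
  have hwc : w ∈ cube w ℓ := by
    intro i
    simp
    positivity
  have haw : dist a w ≤ 6 * (η * d) := by
    have := dist_triangle_right a w x
    linarith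
  refine ⟨w, ?_, ?_, ?_⟩
  · intro y hy
    have hyb : y ∈ Metric.ball w d := by
      rw [Metric.mem_ball]
      linarith [hcc w y hy]
    have hdis : Disjoint (Metric.ball w d) Ω := Set.subset_compl_iff_disjoint_right.1 hball
    exact Set.disjoint_left.1 (hdis.closure_right Metric.isOpen_ball) hyb
  · have h1 : (⨅ a ∈ cube z ℓ, ⨅ b ∈ cube w ℓ, edist a b) ≤ edist a w :=
      (iInf₂_le a ha).trans (iInf₂_le w hwc)
    have h2 := ENNReal.toReal_mono (edist_ne_top a w) h1
    rw [← dist_edist] at h2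
    unfold setDist
    linarith
  · intro y hy i
    have h1 := hcc w y hy
    have h2 := hcc z a ha
    have h3 := dist_triangle4 y w a z
    rw [dist_comm w a] at h3
    have h4 : |y i - z i| ≤ dist y z := by
      rw [dist_eq_norm, ← Real.norm_eq_abs]
      exact PiLp.norm_apply_le (y - z) i
    linarith
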